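/- There is an absolute constant C > 0 such that for every prime p and every multiplicative subgroup Γ of F_p^* with |Γ| ≤ p^{2/3}, the additive energy satisfies E(Γ) ≤ C · |Γ|^{5/2}. -/

import Mathlib

open Finset

/-- Additive energy `E(A) = #{(a₁,a₂,a₃,a₄) ∈ A⁴ : a₁ + a₂ = a₃ + a₄}`. -/
def addEnergy {p : ℕ} (A : Finset (ZMod p)) : ℕ :=
  (((A ×ˢ A) ×ˢ (A ×ˢ A)).filter fun q => q.1.1 + q.1.2 = q.2.1 + q.2.2).card

open Polynomial

theorem natCast_ne_natCast_of_lt {p : ℕ} [Fact p.Prime] {i j : ℕ} (hi : i < p) (hj : j < p)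
    (h : i ≠ j) : (i : ZMod p) ≠ j := by
  intro h'
  rw [ZMod.natCast_eq_natCast_iff'] at h'
  rw [Nat.mod_eq_of_lt hi, Nat.mod_eq_of_lt hj] at h'
  exact h h'

/-- A sparse polynomial of degree less than `p` cannot vanish at `1` to an order as large as the
number of its terms. -/
theorem eq_zero_of_support_subset_of_pow_dvd {p : ℕ} [Fact p.Prime] (s : Finset ℕ)
    (hs : ∀ i ∈ s, i < p) (f : (ZMod p)[X]) (hf : f.support ⊆ s)
    (hdvd : (X - C 1) ^ #s ∣ f) : f = 0 := by
  induction s using Finset.induction_on generalizing f with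
  | empty => simpa using hf
  | insert e s he ih =>
    rw [card_insert_of_notMem he] at hdvd
    have hcoeff : ∀ j : ℕ, (X * derivative f - C (e : ZMod p) * f).coeff j
        = ((j : ZMod p) - e) * f.coeff j := by
      intro j
      cases j with
      | zero => simp
      | succ j => simp [coeff_derivative]; ring
    have hg : X * derivative f - C (e : ZMod p) * f = 0 := by
      refine ih (fun i hi => hs i (mem_insert_of_mem hi)) _ ?_ ?_
      · intro j hj
        rw [mem_support_iff, hcoeff] at hj
        have := hf (mem_support_iff.2 (right_ne_zero_of_mul hj))
        rcases mem_insert.1 this with rfl | h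
        · simp at hj
        · exact h
      · refine dvd_sub (Dvd.dvd.mul_left ?_ _)
          (Dvd.dvd.mul_left ((pow_dvd_pow _ (Nat.le_succ _)).trans hdvd) _)
        simpa using pow_sub_one_dvd_derivative_of_pow_dvd (n := #s + 1) hdvd
    have hz : ∀ j, j ≠ e → f.coeff j = 0 := by
      intro j hj
      by_contra hne
      have hjs := hf (mem_support_iff.2 hne)
      have := hcoeff j
      rw [hg, coeff_zero, eq_comm, mul_eq_zero, sub_eq_zero] at this
      exact this.elim (natCast_ne_natCast_of_lt (hs _ hjs) (hs _ (mem_insert_self _ _)) hj) hne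
    have hmono : f = C (f.coeff e) * X ^ e := by
      ext j
      rw [coeff_C_mul, coeff_X_pow]
      split_ifs with h
      · simp [h]
      · simp [hz j h]
    have hroot : f.eval 1 = 0 := by
      have : X - C 1 ∣ f := (dvd_pow_self _ (Nat.succ_ne_zero _)).trans hdvd
      exact dvd_iff_isRoot.1 this
    rw [hmono] at hroot ⊢
    simp at hroot
    simp [hroot]

theorem eq_zero_of_sum_pow_mul_eq_zero {R : Type*} [CommRing R] [IsDomain R] (G : R) (hG : G ≠ 0)
    (n : ℕ) (F : Fin n → R) (hF : ∀ c, G ∣ F c → F c = 0)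
    (h : ∑ c : Fin n, G ^ (c : ℕ) * F c = 0) (c : Fin n) : F c = 0 := by
  induction n with
  | zero => exact c.elim0
  | succ n ih =>
    rw [Fin.sum_univ_succ] at h
    simp only [Fin.val_zero, pow_zero, one_mul, Fin.val_succ, pow_succ', mul_assoc,
      ← Finset.mul_sum] at h
    have h0 : F 0 = 0 := hF 0 ⟨-∑ i : Fin n, G ^ (i : ℕ) * F i.succ, by linear_combination h⟩
    rw [h0, zero_add] at h
    cases c using Fin.cases with
    | zero => exact h0
    | succ c =>
      exact ih (fun i => F i.succ) (fun i => hF _) ((mul_eq_zero.1 h).resolve_left hG) c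

/-- The products `X ^ a * (X ^ (t * b) * (1 - X) ^ (t * c))` with `a < A` and `b, c < B` are
linearly independent. -/
theorem eq_zero_of_sum_mul_pow_mul_pow_eq_zero {p : ℕ} [Fact p.Prime] {t A B : ℕ}
    (hA : 0 < A) (hAB : A * B ≤ t) (htp : t * B ≤ p)
    (w : Fin A × Fin B × Fin B → ZMod p)
    (h : ∑ i, w i • ((X : (ZMod p)[X]) ^ (i.1 : ℕ) *
      (X ^ (t * i.2.1) * (1 - X) ^ (t * i.2.2))) = 0) : w = 0 := by
  have hexp : ∀ a < A, ∀ b < B, a + t * b < t * B := by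
    intro a ha b hb
    have : A ≤ t := (Nat.le_mul_of_pos_right A (by omega)).trans hAB
    nlinarith
  have hinj : ∀ a < A, ∀ b < B, ∀ a' < A, ∀ b' < B, a + t * b = a' + t * b' →
      a = a' ∧ b = b' := by
    intro a ha b hb a' ha' b' hb' e
    have : A ≤ t := (Nat.le_mul_of_pos_right A (by omega)).trans hAB
    have hb : b = b' := by
      rcases lt_trichotomy b b' with h | h | h
      · nlinarith
      · exact h
      · nlinarith
    subst hb
    exact ⟨by omega, rfl⟩
  let F : Fin B → (ZMod p)[X] := fun c =>
    ∑ ab : Fin A × Fin B, monomial ((ab.1 : ℕ) + t * ab.2) (w (ab.1, ab.2, c))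
  have hcoeff : ∀ (a : Fin A) (b c : Fin B), (F c).coeff (a + t * b) = w (a, b, c) := by
    intro a b c
    simp only [F, finsetSum_coeff, coeff_monomial]
    rw [Finset.sum_eq_single (a, b)]
    · simp
    · rintro ⟨a', b'⟩ - hne
      rw [if_neg]
      intro e
      obtain ⟨h1, h2⟩ := hinj _ a'.2 _ b'.2 _ a.2 _ b.2 e
      exact hne (Prod.ext (Fin.ext h1) (Fin.ext h2))
    · simp
  have hF : ∀ c, (1 - X) ^ t ∣ F c → F c = 0 := by
    intro c hc
    let s : Finset ℕ := univ.image fun ab : Fin A × Fin B => (ab.1 : ℕ) + t * ab.2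
    have hs : #s ≤ t := by
      refine card_image_le.trans ?_
      simpa using hAB
    refine eq_zero_of_support_subset_of_pow_dvd s ?_ _ ?_ ?_
    · intro i hi
      obtain ⟨ab, -, rfl⟩ := mem_image.1 hi
      exact (hexp _ ab.1.2 _ ab.2.2).trans_le htp
    · intro i hi
      by_contra hn
      refine mem_support_iff.1 hi ?_
      simp only [F, finsetSum_coeff, coeff_monomial]
      refine Finset.sum_eq_zero fun ab _ => if_neg ?_
      rintro rfl
      exact hn (mem_image_of_mem _ (mem_univ ab))
    · refine (pow_dvd_pow _ hs).trans ((pow_dvd_pow_of_dvd ?_ t).trans hc)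
      exact ⟨-1, by simp⟩
  have hne : ((1 - X : (ZMod p)[X])) ^ t ≠ 0 := by
    refine pow_ne_zero _ fun h0 => ?_
    have := congrArg (eval 0) h0
    simp at this
  have hsum : ∑ c : Fin B, ((1 - X : (ZMod p)[X]) ^ t) ^ (c : ℕ) * F c = 0 := by
    rw [← h]
    simp only [Fintype.sum_prod_type, F, Finset.mul_sum]
    rw [Finset.sum_comm]
    refine Finset.sum_congr rfl fun a _ => ?_
    rw [Finset.sum_comm]
    refine Finset.sum_congr rfl fun b _ => Finset.sum_congr rfl fun c _ => ?_
    rw [← C_mul_X_pow_eq_monomial, smul_eq_C_mul, pow_add, pow_mul, pow_mul]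
    ring
  ext ⟨a, b, c⟩
  rw [← hcoeff a b c, eq_zero_of_sum_pow_mul_eq_zero _ hne B F hF hsum c]
  simp

/-- The derivation `X (1 - X) d/dX`. -/
noncomputable def eulerDeriv (p : ℕ) [Fact p.Prime] : (ZMod p)[X] →ₗ[ZMod p] (ZMod p)[X] :=
  (LinearMap.mulLeft (ZMod p) (X * (1 - X))).comp derivative

theorem eulerDeriv_apply {p : ℕ} [Fact p.Prime] (f : (ZMod p)[X]) :
    eulerDeriv p f = X * (1 - X) * derivative f := rfl

theorem X_sub_C_pow_dvd_of_eval_eulerDeriv_iterate_eq_zero {p : ℕ} [Fact p.Prime] {x : ZMod p}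
    (h0 : x ≠ 0) (h1 : x ≠ 1) {D : ℕ} (hD : D ≤ p) (f : (ZMod p)[X])
    (h : ∀ n < D, ((eulerDeriv p)^[n] f).eval x = 0) : (X - C x) ^ D ∣ f := by
  induction D generalizing f with
  | zero => simp
  | succ D ih =>
    obtain ⟨g, hg⟩ := ih (by omega) f fun n hn => h n (by omega)
    rcases Nat.eq_zero_or_pos D with rfl | hpos
    · have := h 0 (by omega)
      rw [zero_add, pow_one]
      exact dvd_iff_isRoot.2 this
    have hder : (X - C x) ^ D ∣ derivative f := by
      have := ih (by omega) (eulerDeriv p f) fun n hn => by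
        rw [← Function.iterate_succ_apply]; exact h (n + 1) (by omega)
      rw [eulerDeriv_apply] at this
      refine IsCoprime.dvd_of_dvd_mul_left (IsCoprime.pow_left ?_) this
      refine ((irreducible_X_sub_C x).coprime_iff_not_dvd).2 fun hd => ?_
      have := dvd_iff_isRoot.1 hd
      simp only [IsRoot.def, eval_mul, eval_X, eval_sub, eval_one, mul_eq_zero, sub_eq_zero] at this
      exact this.elim h0 fun h => h1 h.symm
    obtain ⟨E, rfl⟩ : ∃ E, D = E + 1 := ⟨D - 1, by omega⟩
    have hX : (X - C x) ≠ 0 := X_sub_C_ne_zero x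
    have hg' : X - C x ∣ C ((E + 1 : ℕ) : ZMod p) * g := by
      obtain ⟨q, hq⟩ := hder
      refine ⟨q - derivative g, mul_left_cancel₀ (pow_ne_zero E hX) ?_⟩
      rw [hg, derivative_mul, derivative_X_sub_C_pow] at hq
      simp only [Nat.add_sub_cancel] at hq
      simp only [map_natCast] at hq ⊢
      linear_combination hq
    have hne : ((E + 1 : ℕ) : ZMod p) ≠ 0 := by
      have := natCast_ne_natCast_of_lt (p := p) (i := E + 1) (j := 0) (by omega) (by omega)
        (by omega)
      simpa using this
    have : X - C x ∣ g :=
      (IsUnit.dvd_mul_left (isUnit_C.2 hne.isUnit)).1 hg'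
    rw [hg, pow_succ _ (E + 1)]
    exact mul_dvd_mul_left _ this

/-- The operator which `eulerDeriv` induces on the cofactor of `X ^ m * (1 - X) ^ l`. -/
noncomputable def twistedDeriv (p : ℕ) [Fact p.Prime] (m l : ℕ) (f : (ZMod p)[X]) : (ZMod p)[X] :=
  X * (1 - X) * derivative f + ((m : (ZMod p)[X]) * (1 - X) - (l : (ZMod p)[X]) * X) * f

theorem eulerDeriv_mul {p : ℕ} [Fact p.Prime] (m l : ℕ) (f : (ZMod p)[X]) :
    eulerDeriv p (f * (X ^ m * (1 - X) ^ l)) = twistedDeriv p m l f * (X ^ m * (1 - X) ^ l) := by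
  have h1 : X * derivative ((X : (ZMod p)[X]) ^ m) = (m : (ZMod p)[X]) * X ^ m := by
    cases m with
    | zero => simp
    | succ m => rw [derivative_X_pow]; simp; ring
  have h2 : (1 - X) * derivative ((1 - X : (ZMod p)[X]) ^ l)
      = -(l : (ZMod p)[X]) * (1 - X) ^ l := by
    cases l with
    | zero => simp
    | succ l => rw [derivative_pow]; simp; ring
  rw [eulerDeriv_apply, twistedDeriv, derivative_mul, derivative_mul]
  linear_combination f * (1 - X) * (1 - X) ^ l * h1 + f * X * X ^ m * h2

theorem eulerDeriv_iterate_mul {p : ℕ} [Fact p.Prime] (m l n : ℕ) (f : (ZMod p)[X]) :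
    (eulerDeriv p)^[n] (f * (X ^ m * (1 - X) ^ l)) =
      (twistedDeriv p m l)^[n] f * (X ^ m * (1 - X) ^ l) := by
  induction n generalizing f with
  | zero => rfl
  | succ n ih => rw [Function.iterate_succ_apply, eulerDeriv_mul, ih, Function.iterate_succ_apply]

theorem natDegree_twistedDeriv_iterate_le {p : ℕ} [Fact p.Prime] (m l n : ℕ) (f : (ZMod p)[X]) :
    ((twistedDeriv p m l)^[n] f).natDegree ≤ f.natDegree + n := by
  induction n generalizing f with
  | zero => rfl
  | succ n ih =>
    rw [Function.iterate_succ_apply]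
    refine (ih _).trans ?_
    suffices (twistedDeriv p m l f).natDegree ≤ f.natDegree + 1 by omega
    have hlin : (1 - X : (ZMod p)[X]).natDegree ≤ 1 := by compute_degree
    have hq : ((m : (ZMod p)[X]) * (1 - X) - (l : (ZMod p)[X]) * X).natDegree ≤ 1 := by
      compute_degree
    refine natDegree_add_le_of_degree_le ?_ ?_
    · by_cases hf : f.natDegree = 0
      · rw [derivative_of_natDegree_zero hf]; simp
      · have h1 := natDegree_derivative_le f
        have h2 : (X * (1 - X) : (ZMod p)[X]).natDegree ≤ 1 + 1 :=
          natDegree_mul_le_of_le natDegree_X_le hlin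
        refine (natDegree_mul_le_of_le h2 h1).trans ?_
        omega
    · rw [add_comm]
      exact natDegree_mul_le_of_le hq le_rfl

/-- Points `y` at which `y ^ t` and `(1 - y) ^ t` coincide and lie in `V`. -/
def powFiber {p : ℕ} [Fact p.Prime] (t : ℕ) (V : Finset (ZMod p)) : Finset (ZMod p) :=
  {y | y ^ t ∈ V ∧ (1 - y) ^ t = y ^ t}

theorem mem_powFiber {p : ℕ} [Fact p.Prime] {t : ℕ} {V : Finset (ZMod p)} {y : ZMod p} :
    y ∈ powFiber t V ↔ y ^ t ∈ V ∧ (1 - y) ^ t = y ^ t := by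
  simp [powFiber]

/-- Stepanov's method: an auxiliary polynomial vanishing to order `A` at all points of
`powFiber t V`. -/
theorem mul_card_powFiber_le {p : ℕ} [Fact p.Prime] {t A B : ℕ} {V : Finset (ZMod p)}
    (hV : 0 ∉ V) (hA : 0 < A) (hAB : A * B ≤ t) (hcount : 2 * #V * A < B ^ 2)
    (htp : t * B ≤ p) : A * #(powFiber t V) ≤ 2 * (t * B) := by
  have hB : 0 < B := by
    rcases Nat.eq_zero_or_pos B with rfl | h
    · simp at hcount
    · exact h
  have hAt : A ≤ t := (Nat.le_mul_of_pos_right A hB).trans hAB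
  have hAp : A ≤ p := hAt.trans ((Nat.le_mul_of_pos_right t hB).trans htp)
  let W : ℕ → Fin A × Fin B × Fin B → (ZMod p)[X] := fun n i =>
    (twistedDeriv p (t * i.2.1) (t * i.2.2))^[n] (X ^ (i.1 : ℕ))
  let L : (Fin A × Fin B × Fin B → ZMod p) →ₗ[ZMod p] (Fin A × V × Fin (2 * A) → ZMod p) :=
    Matrix.mulVecLin (Matrix.of fun (e : Fin A × V × Fin (2 * A)) (i : Fin A × Fin B × Fin B) =>
      (e.2.1 : ZMod p) ^ ((i.2.1 : ℕ) + i.2.2) * (W e.1 i).coeff e.2.2)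
  have hker : LinearMap.ker L ≠ ⊥ := by
    refine LinearMap.ker_ne_bot_of_finrank_lt ?_
    simp only [Module.finrank_fintype_fun_eq_card, Fintype.card_prod, Fintype.card_fin,
      Fintype.card_coe]
    nlinarith
  obtain ⟨w, hw, hw0⟩ := (Submodule.ne_bot_iff _).1 hker
  set Ψ : (ZMod p)[X] := ∑ i, w i • ((X : (ZMod p)[X]) ^ (i.1 : ℕ) *
      (X ^ (t * i.2.1) * (1 - X) ^ (t * i.2.2))) with hΨ
  have hΨ0 : Ψ ≠ 0 := fun h => hw0 (eq_zero_of_sum_mul_pow_mul_pow_eq_zero hA hAB htp w h)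
  have hzero : ∀ n < A, ∀ v ∈ V,
      ∑ i, w i • (v ^ ((i.2.1 : ℕ) + i.2.2) • W n i) = 0 := by
    intro n hn v hv
    ext k
    rw [coeff_zero, finsetSum_coeff]
    by_cases hk : k < 2 * A
    · have := congrFun (LinearMap.mem_ker.1 hw) (⟨n, hn⟩, ⟨v, hv⟩, ⟨k, hk⟩)
      simp only [L, Matrix.mulVecLin_apply, Matrix.mulVec, dotProduct, Matrix.of_apply,
        Pi.zero_apply] at this
      rw [← this]
      refine Finset.sum_congr rfl fun i _ => ?_
      simp only [coeff_smul, smul_eq_mul]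
      ring
    · refine Finset.sum_eq_zero fun i _ => ?_
      have hdeg := natDegree_twistedDeriv_iterate_le (p := p) (t * i.2.1) (t * i.2.2) n
        (X ^ (i.1 : ℕ))
      rw [natDegree_X_pow] at hdeg
      have hi := i.1.2
      rw [coeff_smul, coeff_smul, coeff_eq_zero_of_natDegree_lt (by
        simp only [W]; omega)]
      simp
  have hdvd : ∀ x ∈ powFiber t V, (X - C x) ^ A ∣ Ψ := by
    intro x hx
    obtain ⟨hxV, hxe⟩ := mem_powFiber.1 hx
    have ht : t ≠ 0 := by omega
    have hx0 : x ≠ 0 := by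
      rintro rfl
      exact hV (by simpa [ht] using hxV)
    have hx1 : x ≠ 1 := by
      rintro rfl
      simp [ht] at hxe
    refine X_sub_C_pow_dvd_of_eval_eulerDeriv_iterate_eq_zero hx0 hx1 hAp _ fun n hn => ?_
    have := congrArg (eval x) (hzero n hn _ hxV)
    rw [← Module.End.coe_pow, hΨ, map_sum, eval_finsetSum]
    rw [eval_finsetSum, eval_zero] at this
    rw [← this]
    refine Finset.sum_congr rfl fun i _ => ?_
    rw [map_smul, Module.End.coe_pow, eulerDeriv_iterate_mul]
    simp only [eval_smul, eval_mul, eval_pow, eval_X, eval_sub, eval_one, pow_mul, hxe,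
      smul_eq_mul, W]
    ring
  have hprod : ∏ x ∈ powFiber t V, (X - C x) ^ A ∣ Ψ :=
    Finset.prod_dvd_of_coprime
      (fun x _ y _ hxy => (isCoprime_X_sub_C_of_isUnit_sub (sub_ne_zero.2 hxy).isUnit).pow) hdvd
  have hdeg := natDegree_le_of_dvd hprod hΨ0
  rw [natDegree_prod_of_monic _ _ fun x _ => (monic_X_sub_C x).pow A] at hdeg
  simp only [natDegree_pow, natDegree_X_sub_C, mul_one, sum_const, smul_eq_mul] at hdeg
  have hΨdeg : Ψ.natDegree ≤ 2 * (t * B) := by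
    refine natDegree_sum_le_of_forall_le _ _ fun i _ => ?_
    refine (natDegree_smul_le _ _).trans ?_
    have hlin : (1 - X : (ZMod p)[X]).natDegree ≤ 1 := by compute_degree
    have h1 : ((1 - X : (ZMod p)[X]) ^ (t * (i.2.2 : ℕ))).natDegree ≤ t * i.2.2 * 1 :=
      natDegree_pow_le_of_le _ hlin
    refine (natDegree_mul_le_of_le (natDegree_X_pow_le _)
      (natDegree_mul_le_of_le (natDegree_X_pow_le _) h1)).trans ?_
    have h2 := i.1.2
    have h3 := i.2.1.2
    have h4 := i.2.2.2
    nlinarith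
  rw [mul_comm]
  exact hdeg.trans hΨdeg

theorem card_powFiber_eq_sum {p : ℕ} [Fact p.Prime] (t : ℕ) (V : Finset (ZMod p)) :
    #(powFiber t V) = ∑ c ∈ V, #(powFiber t {c}) := by
  rw [card_eq_sum_card_fiberwise (f := fun y : ZMod p => y ^ t) (t := V)
    fun y hy => (mem_powFiber.1 hy).1]
  refine Finset.sum_congr rfl fun c hc => congrArg card ?_
  ext y
  simp only [mem_filter, mem_powFiber, mem_singleton]
  constructor
  · rintro ⟨⟨-, h⟩, rfl⟩
    exact ⟨rfl, h⟩
  · rintro ⟨rfl, h⟩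
    exact ⟨⟨hc, h⟩, rfl⟩

theorem card_powFiber_le {p : ℕ} [Fact p.Prime] {t : ℕ} (ht : 0 < t) (V : Finset (ZMod p)) :
    #(powFiber t V) ≤ t := by
  have hne : (X ^ t - (1 - X) ^ t : (ZMod p)[X]) ≠ 0 := fun h => by
    have := congrArg (eval 1) h
    simp [ht.ne'] at this
  have hlin : (1 - X : (ZMod p)[X]).natDegree ≤ 1 := by compute_degree
  have hdeg : (X ^ t - (1 - X) ^ t : (ZMod p)[X]).natDegree ≤ t := by
    refine (natDegree_sub_le_of_le (natDegree_X_pow_le t) (natDegree_pow_le_of_le t hlin)).trans ?_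
    simp
  have hsub : powFiber t V ⊆ (X ^ t - (1 - X) ^ t : (ZMod p)[X]).roots.toFinset := by
    intro y hy
    rw [Multiset.mem_toFinset, mem_roots hne]
    simp [(mem_powFiber.1 hy).2]
  exact (card_le_card hsub).trans
    ((Multiset.toFinset_card_le _).trans ((card_roots' _).trans hdeg))

theorem exists_pow_three_gt (m : ℕ) (hm : 0 < m) : ∃ B, m < B ^ 3 ∧ B ^ 3 ≤ 8 * m := by
  have hex : ∃ B, m < B ^ 3 := ⟨m + 1, by nlinarith [sq_nonneg m]⟩
  refine ⟨Nat.find hex, Nat.find_spec hex, ?_⟩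
  have hmin := @Nat.find_min _ _ hex
  have hspec := Nat.find_spec hex
  generalize Nat.find hex = B at *
  have hB : 2 ≤ B := by
    by_contra hlt
    interval_cases B <;> omega
  obtain ⟨b, rfl⟩ : ∃ b, B = b + 1 := ⟨B - 1, by omega⟩
  have h1 : b ^ 3 ≤ m := not_lt.1 (hmin (m := b) (by omega))
  have h2 : (b + 1) ^ 3 ≤ (2 * b) ^ 3 := Nat.pow_le_pow_left (by omega) 3
  calc (b + 1) ^ 3 ≤ (2 * b) ^ 3 := h2
    _ = 8 * b ^ 3 := by ring
    _ ≤ 8 * m := by omega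

theorem card_mul_pow_three_le_of_sq_card_le {p : ℕ} [Fact p.Prime] {t τ : ℕ}
    {V : Finset (ZMod p)} (hV : 0 ∉ V) (htp : t ^ 3 ≤ p ^ 2) (hτ : ∀ c ∈ V, τ ≤ #(powFiber t {c}))
    (hN : 2 ^ 14 * #V ^ 2 ≤ t) : #V * τ ^ 3 ≤ 2 ^ 14 * t ^ 2 := by
  rcases Nat.eq_zero_or_pos #V with h0 | hNpos
  · simp [h0]
  have hS : #V * τ ≤ #(powFiber t V) := by
    rw [card_powFiber_eq_sum, ← smul_eq_mul]
    exact card_nsmul_le_sum _ _ _ hτ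
  generalize hs : #(powFiber t V) = s at hS
  have ht : 0 < t := by
    rcases Nat.eq_zero_or_pos t with rfl | h
    · nlinarith
    · exact h
  obtain ⟨B, hB1, hB2⟩ := exists_pow_three_gt (2 * #V * t) (by positivity)
  have hB : 0 < B := by
    rcases Nat.eq_zero_or_pos B with rfl | h
    · simp at hB1
    · exact h
  have hB6 : B ^ 6 ≤ 2 ^ 8 * #V ^ 2 * t ^ 2 := by
    calc B ^ 6 = (B ^ 3) ^ 2 := by ring
      _ ≤ (8 * (2 * #V * t)) ^ 2 := Nat.pow_le_pow_left hB2 2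
      _ = 2 ^ 8 * #V ^ 2 * t ^ 2 := by ring
  have hBt : B ^ 2 ≤ t := by
    refine le_of_pow_le_pow_left₀ (n := 3) (by norm_num) (by positivity) ?_
    calc (B ^ 2) ^ 3 = B ^ 6 := by ring
      _ ≤ 2 ^ 8 * #V ^ 2 * t ^ 2 := hB6
      _ ≤ (2 ^ 14 * #V ^ 2) * t ^ 2 := by gcongr <;> norm_num
      _ ≤ t * t ^ 2 := by gcongr
      _ = t ^ 3 := by ring
  have hBp : t * B ≤ p := by
    refine le_of_pow_le_pow_left₀ (n := 2) (by norm_num) (by positivity) ?_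
    calc (t * B) ^ 2 = t ^ 2 * B ^ 2 := by ring
      _ ≤ t ^ 2 * t := by gcongr
      _ = t ^ 3 := by ring
      _ ≤ p ^ 2 := htp
  have hBlet : B ≤ t := by nlinarith
  have hA : 0 < t / B := Nat.div_pos hBlet hB
  have hAB : t / B * B ≤ t := Nat.div_mul_le_self t B
  have hAB' : t < t / B * B + B := Nat.lt_div_mul_add hB
  generalize t / B = A at hA hAB hAB'
  have hcount : 2 * #V * A < B ^ 2 := by
    refine lt_of_mul_lt_mul_right (a := B) ?_ (Nat.zero_le _)
    calc 2 * #V * A * B = 2 * #V * (A * B) := by ring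
      _ ≤ 2 * #V * t := by gcongr
      _ < B ^ 3 := hB1
      _ = B ^ 2 * B := by ring
  have hmain := mul_card_powFiber_le hV hA hAB hcount hBp
  rw [hs] at hmain
  have hs4 : s ≤ 4 * B ^ 2 := by
    have h2 : t ≤ 2 * (A * B) := by nlinarith
    refine le_of_mul_le_mul_left (a := A) ?_ hA
    calc A * s ≤ 2 * (t * B) := hmain
      _ ≤ 2 * (2 * (A * B) * B) := by gcongr
      _ = A * (4 * B ^ 2) := by ring
  refine le_of_mul_le_mul_left (a := #V ^ 2) ?_ (by positivity)
  calc #V ^ 2 * (#V * τ ^ 3) = (#V * τ) ^ 3 := by ring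
    _ ≤ (4 * B ^ 2) ^ 3 := Nat.pow_le_pow_left (hS.trans hs4) 3
    _ = 2 ^ 6 * B ^ 6 := by ring
    _ ≤ 2 ^ 6 * (2 ^ 8 * #V ^ 2 * t ^ 2) := by gcongr
    _ = #V ^ 2 * (2 ^ 14 * t ^ 2) := by ring

theorem card_mul_pow_three_le {p : ℕ} [Fact p.Prime] {t τ : ℕ} (ht : 0 < t)
    {V : Finset (ZMod p)} (hV : 0 ∉ V) (htp : t ^ 3 ≤ p ^ 2) (hτ : ∀ c ∈ V, τ ≤ #(powFiber t {c}))
    (hτt : 2 ^ 16 * t < τ ^ 2) : #V * τ ^ 3 ≤ 2 ^ 14 * t ^ 2 := by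
  by_cases hN : 2 ^ 14 * #V ^ 2 ≤ t
  · exact card_mul_pow_three_le_of_sq_card_le hV htp hτ hN
  exfalso
  obtain ⟨c, hc⟩ : V.Nonempty := by
    rw [← card_pos]
    by_contra h
    exact hN (by simp [show #V = 0 by omega])
  have hτle : τ ≤ t := (hτ c hc).trans (card_powFiber_le ht _)
  have ht16 : 2 ^ 16 < t := by
    by_contra h
    nlinarith
  set N := Nat.sqrt (t / 2 ^ 14)
  have h1 : N ^ 2 ≤ t / 2 ^ 14 := Nat.sqrt_le' _
  have h2 : t / 2 ^ 14 < (N + 1) ^ 2 := Nat.lt_succ_sqrt' _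
  have h3 : 2 ^ 14 * N ^ 2 ≤ t := by omega
  have h4 : t < 2 ^ 14 * (N + 1) ^ 2 := by omega
  have hNV : N ≤ #V := by
    by_contra h
    exact hN (le_trans (by gcongr; omega) h3)
  have hN1 : 1 ≤ N := by
    by_contra h
    have : N = 0 := by omega
    rw [this] at h4
    omega
  obtain ⟨U, hUV, hU⟩ := exists_subset_card_eq hNV
  have hmain := card_mul_pow_three_le_of_sq_card_le (t := t) (τ := τ) (V := U)
    (fun h => hV (hUV h)) htp (fun c hc => hτ c (hUV hc)) (by rw [hU]; exact h3)
  rw [hU] at hmain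
  have h5 : t < 2 ^ 16 * N ^ 2 := by nlinarith
  have h6 : (2 ^ 16 * t) ^ 3 < (τ ^ 2) ^ 3 := Nat.pow_lt_pow_left hτt (by norm_num)
  have h7 : N ^ 2 * (2 ^ 16 * t) ^ 3 ≤ (2 ^ 14 * t ^ 2) ^ 2 := by
    calc N ^ 2 * (2 ^ 16 * t) ^ 3 ≤ N ^ 2 * (τ ^ 2) ^ 3 := by gcongr
      _ = (N * τ ^ 3) ^ 2 := by ring
      _ ≤ _ := Nat.pow_le_pow_left hmain 2
  have h8 : 2 ^ 20 * N ^ 2 ≤ t := by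
    refine le_of_mul_le_mul_left (a := 2 ^ 28 * t ^ 3) ?_ (by positivity)
    nlinarith
  omega

theorem sq_le_sum_Icc_two_mul (n t : ℕ) (h : n ≤ t) :
    n ^ 2 ≤ ∑ τ ∈ Icc 1 t, if τ ≤ n then 2 * τ else 0 := by
  rw [← Finset.sum_filter]
  have : (Icc 1 t).filter (· ≤ n) = Icc 1 n := by
    ext; simp; omega
  rw [this]
  clear this h
  induction n with
  | zero => simp
  | succ n ih =>
    rw [Finset.sum_Icc_succ_top (by omega)]
    nlinarith

theorem sum_Icc_two_mul_mul_le {t : ℕ} (ht : 0 < t) (N : ℕ → ℕ)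
    (hsum : ∑ τ ∈ Icc 1 t, N τ ≤ t)
    (hN : ∀ τ, 2 ^ 16 * t < τ ^ 2 → N τ * τ ^ 3 ≤ 2 ^ 14 * t ^ 2) :
    (∑ τ ∈ Icc 1 t, (2 * τ * N τ : ℝ)) ≤ 1152 * (t : ℝ) * √t := by
  obtain ⟨T, hT⟩ : ∃ T, T = 2 ^ 8 * (Nat.sqrt t + 1) := ⟨_, rfl⟩
  have hTpos : 0 < T := by omega
  have hT0 : (0 : ℝ) < T := by exact_mod_cast hTpos
  have hTt : t * 2 ^ 16 < T ^ 2 := by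
    have := Nat.lt_succ_sqrt' t
    calc t * 2 ^ 16 < (Nat.sqrt t + 1) ^ 2 * 2 ^ 16 := by
          exact Nat.mul_lt_mul_of_pos_right this (by norm_num)
      _ = T ^ 2 := by rw [hT]; ring
  have hs0 : 1 ≤ √(t : ℝ) := Real.one_le_sqrt.2 (by exact_mod_cast ht)
  have hss : √(t : ℝ) * √t = t := Real.mul_self_sqrt (by positivity)
  have hTle : (T : ℝ) ≤ 2 ^ 9 * √t := by
    have := Real.nat_sqrt_le_real_sqrt (a := t)
    rw [hT]
    push_cast
    linarith
  have hTge : 2 ^ 8 * √(t : ℝ) ≤ T := by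
    have := Real.real_sqrt_le_nat_sqrt_succ (a := t)
    rw [hT]
    push_cast
    linarith
  have hterm : ∀ τ ∈ Icc 1 t, (2 * τ * N τ : ℝ) ≤
      2 * T * N τ + if T < τ then 2 ^ 15 * (t : ℝ) ^ 2 * ((τ : ℝ) ^ 2)⁻¹ else 0 := by
    intro τ hτ
    have hτ0 : (0 : ℝ) < τ := by
      exact_mod_cast (mem_Icc.1 hτ).1
    split_ifs with h
    · have h1 : N τ * τ ^ 3 ≤ 2 ^ 14 * t ^ 2 := by
        refine hN τ ?_
        nlinarith
      have h1' : (N τ * τ ^ 3 : ℝ) ≤ 2 ^ 14 * t ^ 2 := by exact_mod_cast h1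
      have h2 : (2 * τ * N τ : ℝ) ≤ 2 ^ 15 * (t : ℝ) ^ 2 * ((τ : ℝ) ^ 2)⁻¹ := by
        rw [← div_eq_mul_inv, le_div_iff₀ (by positivity)]
        nlinarith
      have : (0 : ℝ) ≤ 2 * T * N τ := by positivity
      linarith
    · have : (τ : ℝ) ≤ T := by exact_mod_cast not_lt.1 h
      rw [add_zero]
      gcongr
  have hinv : (∑ τ ∈ Icc 1 t with T < τ, ((τ : ℝ) ^ 2)⁻¹) ≤ (T : ℝ)⁻¹ := by
    have hsub : (Icc 1 t).filter (T < ·) = Ioc T t := by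
      ext; simp; omega
    rw [hsub]
    rcases le_total T t with h | h
    · refine (sum_Ioc_inv_sq_le_sub hTpos.ne' h).trans ?_
      have : (0 : ℝ) ≤ (t : ℝ)⁻¹ := by positivity
      linarith
    · rw [Ioc_eq_empty_of_le h]
      simp
  have hsumR : (∑ τ ∈ Icc 1 t, (N τ : ℝ)) ≤ t := by exact_mod_cast hsum
  have htT : (t : ℝ) ^ 2 * (T : ℝ)⁻¹ ≤ t * √t / 2 ^ 8 := by
    rw [← div_eq_mul_inv, div_le_iff₀ hT0]
    have : (0 : ℝ) ≤ t * √t / 2 ^ 8 := by positivity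
    calc (t : ℝ) ^ 2 = t * √t / 2 ^ 8 * (2 ^ 8 * √t) := by linear_combination -(t : ℝ) * hss
      _ ≤ _ := by gcongr
  calc (∑ τ ∈ Icc 1 t, (2 * τ * N τ : ℝ)) ≤ ∑ τ ∈ Icc 1 t,
        (2 * (T : ℝ) * N τ + if T < τ then 2 ^ 15 * (t : ℝ) ^ 2 * ((τ : ℝ) ^ 2)⁻¹ else 0) :=
      Finset.sum_le_sum hterm
    _ = 2 * T * (∑ τ ∈ Icc 1 t, (N τ : ℝ))
        + 2 ^ 15 * (t : ℝ) ^ 2 * ∑ τ ∈ Icc 1 t with T < τ, ((τ : ℝ) ^ 2)⁻¹ := by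
      rw [sum_add_distrib, ← Finset.sum_filter, Finset.mul_sum, Finset.mul_sum]
    _ ≤ 2 * (2 ^ 9 * √t) * t + 2 ^ 15 * (t : ℝ) ^ 2 * (T : ℝ)⁻¹ := by
      gcongr
    _ ≤ 1152 * (t : ℝ) * √t := by linarith

theorem sum_sq_card_powFiber_le {p : ℕ} [Fact p.Prime] {t : ℕ} (ht : 0 < t)
    (htp : t ^ 3 ≤ p ^ 2) :
    (∑ c ∈ univ.erase (0 : ZMod p), (#(powFiber t {c}) : ℝ) ^ 2)
      ≤ 1152 * (t : ℝ) * √t := by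
  set V : Finset (ZMod p) := univ.erase 0
  set f : ZMod p → ℕ := fun c => #(powFiber t {c})
  set N : ℕ → ℕ := fun τ => #{c ∈ V | τ ≤ f c} with hNdef
  have hV : 0 ∉ V := notMem_erase _ _
  have hft : ∀ c, f c ≤ t := fun c => card_powFiber_le ht _
  have hsumf : ∑ c ∈ V, f c ≤ t := by
    rw [← card_powFiber_eq_sum]
    exact card_powFiber_le ht _
  have hsumN : ∑ τ ∈ Icc 1 t, N τ ≤ t := by
    refine le_trans (le_of_eq ?_) hsumf
    simp only [hNdef, card_filter]
    rw [Finset.sum_comm]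
    refine Finset.sum_congr rfl fun c _ => ?_
    rw [← card_filter]
    have : (Icc 1 t).filter (· ≤ f c) = Icc 1 (f c) := by
      ext
      have := hft c
      simp
      omega
    rw [this]
    simp
  have hsq : ∑ c ∈ V, f c ^ 2 ≤ ∑ τ ∈ Icc 1 t, 2 * τ * N τ := by
    calc ∑ c ∈ V, f c ^ 2 ≤ ∑ c ∈ V, ∑ τ ∈ Icc 1 t, if τ ≤ f c then 2 * τ else 0 :=
          Finset.sum_le_sum fun c _ => sq_le_sum_Icc_two_mul _ _ (hft c)
      _ = ∑ τ ∈ Icc 1 t, 2 * τ * N τ := by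
          rw [Finset.sum_comm]
          refine Finset.sum_congr rfl fun τ _ => ?_
          rw [← Finset.sum_filter, sum_const, smul_eq_mul, mul_comm]
  have hsqR : (∑ c ∈ V, (f c : ℝ) ^ 2) ≤ ∑ τ ∈ Icc 1 t, (2 * τ * N τ : ℝ) := by
    exact_mod_cast hsq
  refine hsqR.trans (sum_Icc_two_mul_mul_le ht N hsumN fun τ hτ => ?_)
  exact card_mul_pow_three_le ht (fun h0 => hV (mem_filter.1 h0).1) htp
    (fun c hc => (mem_filter.1 hc).2) hτ

theorem addEnergy_eq_sum_sq_card {p : ℕ} [Fact p.Prime] (A : Finset (ZMod p)) :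
    _root_.addEnergy A = ∑ d : ZMod p, #{q ∈ A ×ˢ A | q.1 + q.2 = d} ^ 2 := by
  rw [← Finset.addEnergy_eq_sum_sq, Finset.addEnergy_eq_card_filter]
  rfl

theorem pow_card_eq_one_of_mem {p : ℕ} [Fact p.Prime] {Γ : Finset (ZMod p)} (h0 : 0 ∉ Γ)
    (hmul : ∀ x ∈ Γ, ∀ y ∈ Γ, x * y ∈ Γ) {x : ZMod p} (hx : x ∈ Γ) : x ^ #Γ = 1 := by
  have hx0 : x ≠ 0 := fun h => h0 (h ▸ hx)
  have himg : Γ.image (x * ·) = Γ :=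
    eq_of_subset_of_card_le (fun y hy => by
      obtain ⟨z, hz, rfl⟩ := mem_image.1 hy
      exact hmul x hx z hz)
      (card_image_of_injective _ (mul_right_injective₀ hx0)).ge
  have hprod : ∏ y ∈ Γ, y ≠ 0 := prod_ne_zero_iff.2 fun y hy h => h0 (h ▸ hy)
  have : ∏ y ∈ Γ, x * y = ∏ y ∈ Γ, y := by
    conv_rhs => rw [← himg]
    rw [prod_image fun a _ b _ h => mul_right_injective₀ hx0 h]
  rw [prod_mul_distrib, prod_const] at this
  exact mul_right_cancel₀ hprod (this.trans (one_mul _).symm)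

/-- Representations of `d ≠ 0` as a sum of two elements of `Γ` become, after division by `d`,
points of a fiber. -/
theorem card_filter_add_eq_le {p : ℕ} [Fact p.Prime] {Γ : Finset (ZMod p)} {t : ℕ}
    (hΓ : ∀ x ∈ Γ, x ^ t = 1) {d : ZMod p} (hd : d ≠ 0) :
    #{q ∈ Γ ×ˢ Γ | q.1 + q.2 = d} ≤ #(powFiber t {(d ^ t)⁻¹}) := by
  refine card_le_card_of_injOn (fun q => q.1 / d) ?_ ?_
  · rintro ⟨a, b⟩ hq
    simp only [coe_filter, mem_product, Set.mem_ofPred_eq] at hq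
    obtain ⟨⟨ha, hb⟩, hab⟩ := hq
    have h1 : 1 - a / d = b / d := by
      field_simp
      linear_combination -hab
    simp [mem_powFiber, h1, div_pow, hΓ a ha, hΓ b hb]
  · rintro ⟨a, b⟩ hq ⟨a', b'⟩ hq' h
    simp only [coe_filter, mem_product, Set.mem_ofPred_eq] at hq hq'
    have h1 : a = a' := (div_left_inj' hd).1 h
    subst h1
    exact Prod.ext rfl (add_left_cancel (hq.2.trans hq'.2.symm))

theorem card_filter_pow_inv_eq_le {p : ℕ} [Fact p.Prime] {t : ℕ} (ht : 0 < t) (c : ZMod p) :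
    #{d : ZMod p | (d ^ t)⁻¹ = c} ≤ t := by
  have hsub : ({d : ZMod p | (d ^ t)⁻¹ = c} : Finset (ZMod p)) ⊆
      (nthRoots t c⁻¹).toFinset := by
    intro d hd
    rw [Multiset.mem_toFinset, mem_nthRoots ht]
    rw [← (mem_filter.1 hd).2, inv_inv]
  exact (card_le_card hsub).trans ((Multiset.toFinset_card_le _).trans (card_nthRoots _ _))

theorem addEnergy_le_sq_add_mul_sum {p : ℕ} [Fact p.Prime] {Γ : Finset (ZMod p)}
    (hpos : 0 < #Γ) (hΓ : ∀ x ∈ Γ, x ^ #Γ = 1) :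
    _root_.addEnergy Γ ≤ #Γ ^ 2 + #Γ * ∑ c ∈ univ.erase (0 : ZMod p), #(powFiber #Γ {c}) ^ 2 := by
  rw [addEnergy_eq_sum_sq_card, ← add_sum_erase univ _ (mem_univ (0 : ZMod p))]
  gcongr ?_ + ?_
  · refine Nat.pow_le_pow_left ?_ 2
    refine card_le_card_of_injOn (fun q => q.1) ?_ ?_
    · intro q hq
      exact (mem_product.1 (mem_filter.1 hq).1).1
    · rintro ⟨a, b⟩ hq ⟨a', b'⟩ hq' h
      simp only [coe_filter, mem_product, Set.mem_ofPred_eq] at hq hq'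
      have h1 : a = a' := h
      subst h1
      exact Prod.ext rfl (add_left_cancel (hq.2.trans hq'.2.symm))
  · calc ∑ d ∈ univ.erase (0 : ZMod p), #{q ∈ Γ ×ˢ Γ | q.1 + q.2 = d} ^ 2
        ≤ ∑ d ∈ univ.erase (0 : ZMod p), #(powFiber #Γ {(d ^ #Γ)⁻¹}) ^ 2 :=
          Finset.sum_le_sum fun d hd =>
            Nat.pow_le_pow_left (card_filter_add_eq_le hΓ (ne_of_mem_erase hd)) 2
      _ = ∑ c ∈ univ.erase (0 : ZMod p), ∑ d ∈ univ.erase (0 : ZMod p) with (d ^ #Γ)⁻¹ = c,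
            #(powFiber #Γ {(d ^ #Γ)⁻¹}) ^ 2 := by
          refine (sum_fiberwise_of_maps_to (fun d hd => ?_) _).symm
          simpa using fun h => absurd h (ne_of_mem_erase hd)
      _ ≤ ∑ c ∈ univ.erase (0 : ZMod p), #Γ * #(powFiber #Γ {c}) ^ 2 := by
          refine Finset.sum_le_sum fun c _ => ?_
          rw [Finset.sum_congr rfl fun d hd => by rw [(mem_filter.1 hd).2], sum_const,
            smul_eq_mul]
          refine Nat.mul_le_mul_right _ ?_
          exact (card_le_card (filter_subset_filter _ (erase_subset _ _))).trans
            (card_filter_pow_inv_eq_le hpos c)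
      _ = _ := (Finset.mul_sum _ _ _).symm

/-- There is an absolute constant `C > 0` such that for every prime `p` and
every multiplicative subgroup `Γ ⊆ F_p^*` with `|Γ| ≤ p^{2/3}`, one has
`E(Γ) ≤ C · |Γ|^{5/2}`. -/
theorem stmt4 :
    ∃ C : ℝ, 0 < C ∧
      ∀ (p : ℕ) [Fact p.Prime], ∀ Γ : Finset (ZMod p),
        (0 : ZMod p) ∉ Γ → (1 : ZMod p) ∈ Γ →
        (∀ x ∈ Γ, ∀ y ∈ Γ, x * y ∈ Γ) → (∀ x ∈ Γ, x⁻¹ ∈ Γ) →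
        (Γ.card : ℝ) ≤ (p : ℝ) ^ ((2 : ℝ) / 3) →
        (addEnergy Γ : ℝ) ≤ C * (Γ.card : ℝ) ^ ((5 : ℝ) / 2) := by
  refine ⟨1153, by norm_num, fun p _ Γ h0 h1 hmul _ hcard => ?_⟩
  have hpos : 0 < #Γ := card_pos.2 ⟨1, h1⟩
  have hR : (1 : ℝ) ≤ #Γ := by exact_mod_cast hpos
  have htp : #Γ ^ 3 ≤ p ^ 2 := by
    have h2 : (#Γ : ℝ) ^ 3 ≤ (p : ℝ) ^ 2 := by
      calc (#Γ : ℝ) ^ 3 ≤ ((p : ℝ) ^ ((2 : ℝ) / 3)) ^ 3 := by gcongr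
        _ = (p : ℝ) ^ 2 := by
          rw [← Real.rpow_natCast, ← Real.rpow_mul (by positivity), ← Real.rpow_natCast]
          norm_num
    exact_mod_cast h2
  have hE := addEnergy_le_sq_add_mul_sum hpos fun x hx => pow_card_eq_one_of_mem h0 hmul hx
  have hER : (_root_.addEnergy Γ : ℝ) ≤
      (#Γ : ℝ) ^ 2 + #Γ * ∑ c ∈ univ.erase (0 : ZMod p), (#(powFiber #Γ {c}) : ℝ) ^ 2 := by
    exact_mod_cast hE
  have hpow : (#Γ : ℝ) ^ ((5 : ℝ) / 2) = (#Γ : ℝ) ^ 2 * √(#Γ : ℝ) := by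
    rw [Real.sqrt_eq_rpow, ← Real.rpow_natCast, ← Real.rpow_add (by linarith)]
    norm_num
  rw [hpow]
  have hs : 1 ≤ √(#Γ : ℝ) := Real.one_le_sqrt.2 hR
  calc (_root_.addEnergy Γ : ℝ) ≤ _ := hER
    _ ≤ (#Γ : ℝ) ^ 2 + #Γ * (1152 * (#Γ : ℝ) * √(#Γ : ℝ)) := by
      gcongr
      exact sum_sq_card_powFiber_le hpos htp
    _ ≤ 1153 * ((#Γ : ℝ) ^ 2 * √(#Γ : ℝ)) := by
      nlinarith [mul_le_mul_of_nonneg_left hs (sq_nonneg (#Γ : ℝ))]
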